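/- arXiv:1310.8487 — 4 statements merged into one kernel-verified Lean document; each statement's English description precedes it below -/
import Mathlib

section
/- Let M ≥ 1 be an integer, θ ∈ ℝ, and S_0,…,S_{M−1} ∈ ℝ. Define the M×M complex matrix A by A(l,m) = (1/M)·∑_{k=0}^{M−1} S_k·exp(i(l−m)θ_k) for l,m ∈ {0,…,M−1}, where θ_k := (θ − 2πk)/M. Then det A = ∏_{k=0}^{M−1} S_k. -/
open Complex Finset Matrix

/-- Orthogonality of characters sampled at the points `(θ - 2πk)/M`. -/
theorem sum_exp_sub_mul_aliased_frequency (M : ℕ) (hM : 1 ≤ M) (θ : ℝ) (l m : Fin M) :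
    ∑ k : Fin M, Complex.exp (Complex.I * (((l : ℕ) : ℂ) - ((m : ℕ) : ℂ)) *
      (((θ - 2 * Real.pi * ((k : ℕ) : ℝ)) / (M : ℝ) : ℝ) : ℂ)) = if l = m then (M : ℂ) else 0 := by
  split_ifs with h
  · simp [h]
  have hM0 : (M : ℂ) ≠ 0 := by exact_mod_cast (by omega : M ≠ 0)
  set r : ℂ := Complex.exp (2 * Real.pi * Complex.I * (((m : ℕ) : ℂ) - ((l : ℕ) : ℂ)) / M) with hr
  have hterm (k : ℕ) : Complex.exp (Complex.I * (((l : ℕ) : ℂ) - ((m : ℕ) : ℂ)) *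
      (((θ - 2 * Real.pi * (k : ℝ)) / (M : ℝ) : ℝ) : ℂ)) =
      Complex.exp (Complex.I * (((l : ℕ) : ℂ) - ((m : ℕ) : ℂ)) * (θ / M)) * r ^ k := by
    rw [hr, ← Complex.exp_nat_mul, ← Complex.exp_add]
    congr 1
    push_cast
    ring
  have hrM : r ^ M = 1 := by
    rw [hr, ← Complex.exp_nat_mul, Complex.exp_eq_one_iff]
    refine ⟨(m : ℕ) - (l : ℕ), ?_⟩
    push_cast
    field_simp
  have hr1 : r ≠ 1 := by
    rw [hr, Ne, Complex.exp_eq_one_iff]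
    rintro ⟨n, hn⟩
    have hc : (((m : ℕ) : ℂ) - ((l : ℕ) : ℂ)) = n * M := by
      have hne := Complex.two_pi_I_ne_zero
      rw [div_eq_iff hM0] at hn
      apply mul_left_cancel₀ hne
      linear_combination hn
    have hz : ((m : ℕ) : ℤ) - ((l : ℕ) : ℤ) = n * M := by exact_mod_cast hc
    have hzero : ((m : ℕ) : ℤ) - ((l : ℕ) : ℤ) = 0 :=
      Int.eq_zero_of_abs_lt_dvd (Dvd.intro_left n hz.symm) (by
        rw [abs_lt]
        omega)
    exact h (Fin.ext (by omega))
  simp_rw [hterm]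
  rw [← Finset.mul_sum, Fin.sum_univ_eq_sum_range (fun k => r ^ k), geom_sum_eq hr1, hrM]
  simp

/-- The determinant of the aliased PSD matrix equals the product of the aliased PSD values. -/
theorem aliased_psd_matrix_det
    (M : ℕ) (hM : 1 ≤ M) (θ : ℝ) (S : Fin M → ℝ)
    (A : Matrix (Fin M) (Fin M) ℂ)
    (hA : ∀ l m : Fin M, A l m =
      (1 / (M : ℂ)) * ∑ k : Fin M, (S k : ℂ) *
        Complex.exp (Complex.I * (((l : ℕ) : ℂ) - ((m : ℕ) : ℂ)) *
          (((θ - 2 * Real.pi * ((k : ℕ) : ℝ)) / (M : ℝ) : ℝ) : ℂ))) :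
    A.det = ∏ k : Fin M, (S k : ℂ) := by
  have hM0 : (M : ℂ) ≠ 0 := by exact_mod_cast (by omega : M ≠ 0)
  let t : Fin M → ℂ := fun k => (((θ - 2 * Real.pi * ((k : ℕ) : ℝ)) / (M : ℝ) : ℝ) : ℂ)
  let U : Matrix (Fin M) (Fin M) ℂ :=
    Matrix.of fun l k => 1 / (M : ℂ) * Complex.exp (Complex.I * ((l : ℕ) : ℂ) * t k)
  let V : Matrix (Fin M) (Fin M) ℂ :=
    Matrix.of fun k m => Complex.exp (-(Complex.I * ((m : ℕ) : ℂ) * t k))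
  have hexp (l m k : Fin M) : Complex.exp (Complex.I * (((l : ℕ) : ℂ) - ((m : ℕ) : ℂ)) * t k) =
      Complex.exp (Complex.I * ((l : ℕ) : ℂ) * t k) *
        Complex.exp (-(Complex.I * ((m : ℕ) : ℂ) * t k)) := by
    rw [← Complex.exp_add]
    ring_nf
  have hUV : U * V = 1 := by
    ext l m
    have h := sum_exp_sub_mul_aliased_frequency M hM θ l m
    change ∑ k, Complex.exp (Complex.I * (((l : ℕ) : ℂ) - ((m : ℕ) : ℂ)) * t k) = _ at h
    simp_rw [hexp] at h
    simp only [Matrix.mul_apply, U, V, Matrix.of_apply, mul_assoc (1 / (M : ℂ))]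
    rw [← Finset.mul_sum, h, Matrix.one_apply]
    split_ifs <;> simp [hM0]
  have hfac : A = U * Matrix.diagonal (fun k => (S k : ℂ)) * V := by
    ext l m
    rw [hA, Matrix.mul_apply, Finset.mul_sum]
    refine Finset.sum_congr rfl fun k _ => ?_
    rw [Matrix.mul_diagonal]
    change _ * (_ * Complex.exp (Complex.I * (((l : ℕ) : ℂ) - ((m : ℕ) : ℂ)) * t k)) = _
    rw [hexp]
    simp only [U, V, Matrix.of_apply]
    ring
  have hdet : U.det * V.det = 1 := by rw [← Matrix.det_mul, hUV, Matrix.det_one]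
  rw [hfac, Matrix.det_mul, Matrix.det_mul, Matrix.det_diagonal]
  linear_combination (∏ k : Fin M, (S k : ℂ)) * hdet
end

section
/- Let M ≥ 1 be an integer, θ ∈ ℝ, S_0,…,S_{M−1} ∈ ℝ with S_k ≠ 0 for every k, and c_0,…,c_{M−1} ∈ ℂ. Define the M×M complex matrix A by A(l,m) = (1/M)·∑_{k=0}^{M−1} S_k·exp(i(l−m)θ_k), the vector s ∈ ℂ^M by s_l = (1/M)·∑_{k=0}^{M−1} c_k·exp(i l θ_k), and the vector v ∈ ℂ^M by v_l = (1/M)·∑_{k=0}^{M−1} (c_k/S_k)·exp(i l θ_k), where θ_k := (θ − 2πk)/M and l,m ∈ {0,…,M−1}. Then A·v = s (matrix–vector product). -/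
open Complex Finset Matrix

/-- Orthogonality of the characters sampled at the nodes `(θ - 2πk)/M`. -/
lemma sum_exp_aliased_node_sub {M : ℕ} (θ : ℝ) (j k : Fin M) :
    ∑ n : Fin M, Complex.exp (Complex.I * ((n : ℕ) : ℂ) *
      ((((θ - 2 * Real.pi * ((j : ℕ) : ℝ)) / (M : ℝ) : ℝ) : ℂ) -
        (((θ - 2 * Real.pi * ((k : ℕ) : ℝ)) / (M : ℝ) : ℝ) : ℂ))) =
      if j = k then (M : ℂ) else 0 := by
  split_ifs with h
  · simp [h]
  have hM : M ≠ 0 := (Nat.zero_lt_of_lt j.isLt).ne'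
  have hMC : (M : ℂ) ≠ 0 := Nat.cast_ne_zero.mpr hM
  have hζ := Complex.isPrimitiveRoot_exp M hM
  set ζ := Complex.exp (2 * Real.pi * Complex.I / M) with hζ_def
  have hz (n : Fin M) : Complex.exp (Complex.I * ((n : ℕ) : ℂ) *
      ((((θ - 2 * Real.pi * ((j : ℕ) : ℝ)) / (M : ℝ) : ℝ) : ℂ) -
        (((θ - 2 * Real.pi * ((k : ℕ) : ℝ)) / (M : ℝ) : ℝ) : ℂ))) =
      (ζ ^ (k : ℕ) / ζ ^ (j : ℕ)) ^ (n : ℕ) := by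
    rw [hζ_def, ← Complex.exp_nat_mul, ← Complex.exp_nat_mul, ← Complex.exp_sub,
      ← Complex.exp_nat_mul]
    congr 1
    push_cast
    field_simp
    ring
  have hne : ζ ^ (k : ℕ) / ζ ^ (j : ℕ) ≠ 1 := fun h1 ↦ h <| Fin.ext <|
    (hζ.pow_inj k.isLt j.isLt (eq_of_div_eq_one h1)).symm
  simp_rw [hz]
  rw [Fin.sum_univ_eq_sum_range (fun n ↦ (ζ ^ (k : ℕ) / ζ ^ (j : ℕ)) ^ n), geom_sum_eq hne,
    div_pow, ← pow_mul, ← pow_mul, mul_comm (k : ℕ), mul_comm (j : ℕ), pow_mul, pow_mul,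
    hζ.pow_eq_one]
  simp

/-- Closed form for `A⁻¹ s`: the aliased PSD matrix `A` maps the vector
`v_l = (1/M)∑_k (c_k/S_k) e^{i l θ_k}` to `s_l = (1/M)∑_k c_k e^{i l θ_k}`. -/
theorem aliased_psd_matrix_mulVec
    (M : ℕ) (hM : 1 ≤ M) (θ : ℝ) (S : Fin M → ℝ) (hS : ∀ k, S k ≠ 0)
    (c : Fin M → ℂ)
    (A : Matrix (Fin M) (Fin M) ℂ) (s v : Fin M → ℂ)
    (hA : ∀ l m : Fin M, A l m =
      (1 / (M : ℂ)) * ∑ k : Fin M, (S k : ℂ) *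
        Complex.exp (Complex.I * (((l : ℕ) : ℂ) - ((m : ℕ) : ℂ)) *
          (((θ - 2 * Real.pi * ((k : ℕ) : ℝ)) / (M : ℝ) : ℝ) : ℂ)))
    (hs : ∀ l : Fin M, s l =
      (1 / (M : ℂ)) * ∑ k : Fin M, c k *
        Complex.exp (Complex.I * ((l : ℕ) : ℂ) *
          (((θ - 2 * Real.pi * ((k : ℕ) : ℝ)) / (M : ℝ) : ℝ) : ℂ)))
    (hv : ∀ l : Fin M, v l =
      (1 / (M : ℂ)) * ∑ k : Fin M, (c k / (S k : ℂ)) *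
        Complex.exp (Complex.I * ((l : ℕ) : ℂ) *
          (((θ - 2 * Real.pi * ((k : ℕ) : ℝ)) / (M : ℝ) : ℝ) : ℂ))) :
    A.mulVec v = s := by
  have hMC : (M : ℂ) ≠ 0 := Nat.cast_ne_zero.mpr (by lia)
  have horth := sum_exp_aliased_node_sub (M := M) θ
  set t : Fin M → ℂ := fun k ↦ (((θ - 2 * Real.pi * ((k : ℕ) : ℝ)) / (M : ℝ) : ℝ) : ℂ)
  change ∀ j k, ∑ n : Fin M, Complex.exp (Complex.I * ((n : ℕ) : ℂ) * (t j - t k)) = _ at horth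
  ext l
  calc A.mulVec v l
      = ∑ m : Fin M, ∑ k : Fin M, ∑ j : Fin M, (1 / (M : ℂ)) ^ 2 *
          (S k * (c j / S j) * Complex.exp (Complex.I * ((l : ℕ) : ℂ) * t k) *
            Complex.exp (Complex.I * ((m : ℕ) : ℂ) * (t j - t k))) := by
        rw [Matrix.mulVec, dotProduct]
        refine Finset.sum_congr rfl fun m _ ↦ ?_
        rw [hA, hv, mul_mul_mul_comm, Finset.sum_mul_sum, Finset.mul_sum]
        refine Finset.sum_congr rfl fun k _ ↦ ?_
        rw [Finset.mul_sum]
        refine Finset.sum_congr rfl fun j _ ↦ ?_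
        have hexp : Complex.exp (Complex.I * (((l : ℕ) : ℂ) - ((m : ℕ) : ℂ)) * t k) *
            Complex.exp (Complex.I * ((m : ℕ) : ℂ) * t j) =
            Complex.exp (Complex.I * ((l : ℕ) : ℂ) * t k) *
              Complex.exp (Complex.I * ((m : ℕ) : ℂ) * (t j - t k)) := by
          rw [← Complex.exp_add, ← Complex.exp_add]
          ring_nf
        linear_combination (1 / (M : ℂ)) ^ 2 * (S k * (c j / S j)) * hexp
    _ = ∑ k : Fin M, ∑ j : Fin M, (1 / (M : ℂ)) ^ 2 *
          (S k * (c j / S j) * Complex.exp (Complex.I * ((l : ℕ) : ℂ) * t k) *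
            if j = k then (M : ℂ) else 0) := by
        rw [Finset.sum_comm]
        refine Finset.sum_congr rfl fun k _ ↦ ?_
        rw [Finset.sum_comm]
        refine Finset.sum_congr rfl fun j _ ↦ ?_
        rw [← horth, ← Finset.mul_sum, ← Finset.mul_sum]
    _ = s l := by
        rw [hs, Finset.mul_sum]
        refine Finset.sum_congr rfl fun k _ ↦ ?_
        have hSk : (S k : ℂ) ≠ 0 := Complex.ofReal_ne_zero.mpr (hS k)
        simp only [mul_ite, mul_zero, Finset.sum_ite_eq', Finset.mem_univ, if_true]
        change _ = 1 / (M : ℂ) * (c k * Complex.exp (Complex.I * ((l : ℕ) : ℂ) * t k))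
        field_simp
end

section
/- Let M ≥ 1 be an integer, θ ∈ ℝ, S_0,…,S_{M−1} ∈ ℝ with S_k > 0 for every k, and c_0,…,c_{M−1} ∈ ℂ. Define the M×M complex matrix A by A(l,m) = (1/M)·∑_{k=0}^{M−1} S_k·exp(i(l−m)θ_k) and the vector s ∈ ℂ^M by s_l = (1/M)·∑_{k=0}^{M−1} c_k·exp(i l θ_k), where θ_k := (θ − 2πk)/M and l,m ∈ {0,…,M−1}. Then A is invertible and the Hermitian quadratic form satisfies sᴴ·A⁻¹·s = (1/M)·∑_{k=0}^{M−1} ‖c_k‖²/S_k (equality in ℂ, the right-hand side being a nonnegative real number). -/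
open Complex Finset Matrix

/-- The Vandermonde matrix of the nodes `exp (i (θ - 2πk) / M)` has orthogonal columns. -/
theorem conjTranspose_mul_self_shifted_dft (M : ℕ) [NeZero M] (θ : ℝ)
    (V : Matrix (Fin M) (Fin M) ℂ)
    (hV : ∀ l k : Fin M, V l k = Complex.exp (Complex.I * ((l : ℕ) : ℂ) *
      (((θ - 2 * Real.pi * ((k : ℕ) : ℝ)) / (M : ℝ) : ℝ) : ℂ))) :
    Vᴴ * V = (M : ℂ) • (1 : Matrix (Fin M) (Fin M) ℂ) := by
  have hM : (M : ℂ) ≠ 0 := NeZero.ne _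
  have hζ := Complex.isPrimitiveRoot_exp M (NeZero.ne M)
  set ζ := Complex.exp (2 * Real.pi * Complex.I / M) with hζ_def
  have hζ0 : ζ ≠ 0 := Complex.exp_ne_zero _
  have hterm : ∀ j k l : Fin M,
      star (V l j) * V l k = (ζ ^ (j : ℕ) / ζ ^ (k : ℕ)) ^ (l : ℕ) := by
    intro j k l
    rw [hV, hV, hζ_def, ← Complex.exp_nat_mul, ← Complex.exp_nat_mul, ← Complex.exp_sub,
      ← Complex.exp_nat_mul, Complex.star_def, ← Complex.exp_conj, ← Complex.exp_add]
    congr 1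
    simp only [map_mul, Complex.conj_I, Complex.conj_ofReal, map_natCast]
    push_cast
    field_simp
    ring
  ext j k
  simp only [mul_apply, conjTranspose_apply, hterm, Matrix.smul_apply, smul_eq_mul]
  rw [Fin.sum_univ_eq_sum_range (fun l => (ζ ^ (j : ℕ) / ζ ^ (k : ℕ)) ^ l)]
  by_cases h : j = k
  · subst h
    simp [div_self (pow_ne_zero (j : ℕ) hζ0)]
  · have hne : ζ ^ (j : ℕ) / ζ ^ (k : ℕ) ≠ 1 := fun h1 =>
      h (Fin.ext (hζ.pow_inj j.2 k.2 ((div_eq_one_iff_eq (pow_ne_zero _ hζ0)).1 h1)))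
    rw [geom_sum_eq hne, div_pow, ← pow_mul, ← pow_mul, mul_comm (j : ℕ), mul_comm (k : ℕ),
      pow_mul, pow_mul, hζ.pow_eq_one]
    simp [one_apply_ne h]

/-- If `Vᴴ V = r`, then `r⁻¹ V D Vᴴ` has inverse `r⁻¹ V D⁻¹ Vᴴ`. -/
theorem smul_mul_diagonal_mul_conjTranspose_mul_inv {n : Type*} [Fintype n] [DecidableEq n]
    {V : Matrix n n ℂ} {r : ℂ} (hr : r ≠ 0) (hV : Vᴴ * V = r • (1 : Matrix n n ℂ))
    {d : n → ℂ} (hd : ∀ k, d k ≠ 0) :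
    (r⁻¹ • (V * diagonal d * Vᴴ)) * (r⁻¹ • (V * diagonal d⁻¹ * Vᴴ)) = 1 := by
  have hVinv : V * (r⁻¹ • Vᴴ) = 1 := by
    rw [mul_eq_one_comm, smul_mul, hV, smul_smul, inv_mul_cancel₀ hr, one_smul]
  have hdd : diagonal d * diagonal d⁻¹ = (1 : Matrix n n ℂ) := by
    rw [diagonal_mul_diagonal, ← diagonal_one]
    congr 1
    ext k
    exact mul_inv_cancel₀ (hd k)
  calc (r⁻¹ • (V * diagonal d * Vᴴ)) * (r⁻¹ • (V * diagonal d⁻¹ * Vᴴ))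
      = r⁻¹ • r⁻¹ • (V * diagonal d * (Vᴴ * V) * diagonal d⁻¹ * Vᴴ) := by
        simp only [smul_mul, Matrix.mul_smul, Matrix.mul_assoc]
    _ = r⁻¹ • (V * (diagonal d * diagonal d⁻¹) * Vᴴ) := by
        rw [hV]
        simp only [smul_mul, Matrix.mul_smul, Matrix.mul_one, Matrix.mul_assoc]
        rw [inv_smul_smul₀ hr]
    _ = 1 := by rw [hdd, Matrix.mul_one, ← Matrix.mul_smul, hVinv]

/-- The aliased PSD matrix with positive diagonalized entries is invertible, and the
Hermitian quadratic form `sᴴ A⁻¹ s` evaluates to `(1/M)∑_k ‖c_k‖²/S_k`. -/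
theorem aliased_psd_quadratic_form
    (M : ℕ) (hM : 1 ≤ M) (θ : ℝ) (S : Fin M → ℝ) (hS : ∀ k, 0 < S k)
    (c : Fin M → ℂ)
    (A : Matrix (Fin M) (Fin M) ℂ) (s : Fin M → ℂ)
    (hA : ∀ l m : Fin M, A l m =
      (1 / (M : ℂ)) * ∑ k : Fin M, (S k : ℂ) *
        Complex.exp (Complex.I * (((l : ℕ) : ℂ) - ((m : ℕ) : ℂ)) *
          (((θ - 2 * Real.pi * ((k : ℕ) : ℝ)) / (M : ℝ) : ℝ) : ℂ)))
    (hs : ∀ l : Fin M, s l =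
      (1 / (M : ℂ)) * ∑ k : Fin M, c k *
        Complex.exp (Complex.I * ((l : ℕ) : ℂ) *
          (((θ - 2 * Real.pi * ((k : ℕ) : ℝ)) / (M : ℝ) : ℝ) : ℂ))) :
    IsUnit A ∧
      ∑ l : Fin M, ∑ m : Fin M, (starRingEnd ℂ) (s l) * A⁻¹ l m * s m
        = (((1 / (M : ℝ)) * ∑ k : Fin M, ‖c k‖ ^ 2 / S k : ℝ) : ℂ) := by
  have : NeZero M := ⟨by omega⟩
  have hM0 : (M : ℂ) ≠ 0 := NeZero.ne _
  obtain ⟨V, hVdef⟩ : ∃ V : Matrix (Fin M) (Fin M) ℂ, ∀ l k : Fin M,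
      V l k = Complex.exp (Complex.I * ((l : ℕ) : ℂ) *
        (((θ - 2 * Real.pi * ((k : ℕ) : ℝ)) / (M : ℝ) : ℝ) : ℂ)) := ⟨fun _ _ => _, fun _ _ => rfl⟩
  have hV := conjTranspose_mul_self_shifted_dft M θ V hVdef
  set d : Fin M → ℂ := fun k => (S k : ℂ) with hd_def
  have hd : ∀ k, d k ≠ 0 := fun k => Complex.ofReal_ne_zero.2 (hS k).ne'
  have hA' : A = (M : ℂ)⁻¹ • (V * diagonal d * Vᴴ) := by
    ext l m
    rw [hA, Matrix.smul_apply, smul_eq_mul, one_div, mul_apply]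
    congr 1
    refine sum_congr rfl fun k _ => ?_
    rw [mul_diagonal, conjTranspose_apply, hVdef, hVdef, Complex.star_def, ← Complex.exp_conj,
      mul_comm _ (d k), mul_assoc (d k), ← Complex.exp_add]
    simp only [map_mul, Complex.conj_I, Complex.conj_ofReal, map_natCast, hd_def]
    congr 2
    ring
  have hs' : s = (M : ℂ)⁻¹ • (V *ᵥ c) := by
    ext l
    rw [hs, Pi.smul_apply, smul_eq_mul, one_div, mulVec, dotProduct]
    congr 1
    exact sum_congr rfl fun k _ => by rw [hVdef, mul_comm]
  have hmul : A * ((M : ℂ)⁻¹ • (V * diagonal d⁻¹ * Vᴴ)) = 1 :=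
    hA' ▸ smul_mul_diagonal_mul_conjTranspose_mul_inv hM0 hV hd
  refine ⟨IsUnit.of_mul_eq_one _ hmul, ?_⟩
  have hVs : Vᴴ *ᵥ s = c := by
    rw [hs', mulVec_smul, mulVec_mulVec, hV, smul_mulVec, one_mulVec, smul_smul,
      inv_mul_cancel₀ hM0, one_smul]
  have hsV : star s ᵥ* V = star c := by
    rw [← hVs, star_mulVec, conjTranspose_conjTranspose]
  calc ∑ l : Fin M, ∑ m : Fin M, (starRingEnd ℂ) (s l) * A⁻¹ l m * s m
      = star s ⬝ᵥ (A⁻¹ *ᵥ s) := by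
        simp only [dotProduct, mulVec, mul_sum, mul_assoc, Pi.star_apply, Complex.star_def]
    _ = (M : ℂ)⁻¹ * (star c ⬝ᵥ (diagonal d⁻¹ *ᵥ c)) := by
        rw [inv_eq_right_inv hmul, smul_mulVec, dotProduct_smul, ← mulVec_mulVec, hVs,
          ← mulVec_mulVec, dotProduct_mulVec, hsV, smul_eq_mul]
    _ = (((1 / (M : ℝ)) * ∑ k : Fin M, ‖c k‖ ^ 2 / S k : ℝ) : ℂ) := by
        push_cast
        rw [one_div, dotProduct]
        congr 1
        refine sum_congr rfl fun k _ => ?_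
        rw [mulVec_diagonal, Pi.star_apply, Complex.star_def, Pi.inv_apply, ← Complex.conj_mul']
        simp only [hd_def]
        ring
end

section
/- Let M ≥ 1 be an integer, θ ∈ ℝ, S_0,…,S_{M−1} ∈ ℝ with S_k > 0 for every k, c_0,…,c_{M−1} ∈ ℂ, and p ∈ ℝ. Define the M×M complex matrix A by A(l,m) = (1/M)·∑_{k=0}^{M−1} S_k·exp(i(l−m)θ_k) and the vector s ∈ ℂ^M by s_l = (1/M)·∑_{k=0}^{M−1} c_k·exp(i l θ_k), where θ_k := (θ − 2πk)/M, and let B = [[A, s],[sᴴ, p]] be the (M+1)×(M+1) bordered matrix. Then det A ≠ 0 and det B / det A = p − (1/M)·∑_{k=0}^{M−1} ‖c_k‖²/S_k. -/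
open Complex Finset Matrix

/-- The phase-shifted discrete Fourier matrix, with nodes `(θ - 2πk)/M`. -/
noncomputable def phasedFourier (M : ℕ) (θ : ℝ) : Matrix (Fin M) (Fin M) ℂ :=
  Matrix.of fun l k => Complex.exp (Complex.I * ((l : ℕ) : ℂ) *
    (((θ - 2 * Real.pi * ((k : ℕ) : ℝ)) / (M : ℝ) : ℝ) : ℂ))

theorem star_phasedFourier_apply (M : ℕ) (θ : ℝ) (l k : Fin M) :
    star (phasedFourier M θ l k) = Complex.exp (-(Complex.I * ((l : ℕ) : ℂ) *
      (((θ - 2 * Real.pi * ((k : ℕ) : ℝ)) / (M : ℝ) : ℝ) : ℂ))) := by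
  simp only [phasedFourier, Matrix.of_apply, Complex.star_def, ← Complex.exp_conj, map_mul,
    Complex.conj_I, Complex.conj_ofReal, map_natCast, neg_mul]

theorem phasedFourier_conjTranspose_mul_self (M : ℕ) (θ : ℝ) :
    (phasedFourier M θ)ᴴ * phasedFourier M θ = (M : ℂ) • 1 := by
  ext j k
  have hM : (M : ℂ) ≠ 0 := Nat.cast_ne_zero.mpr (Fin.pos j).ne'
  set r : ℂ := Complex.exp (2 * Real.pi * Complex.I * (((j : ℕ) : ℂ) - ((k : ℕ) : ℂ)) / M) with hr
  have hsum : ((phasedFourier M θ)ᴴ * phasedFourier M θ) j k = ∑ l ∈ range M, r ^ l := by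
    rw [Matrix.mul_apply, ← Fin.sum_univ_eq_sum_range]
    refine Finset.sum_congr rfl fun l _ => ?_
    rw [Matrix.conjTranspose_apply, star_phasedFourier_apply, phasedFourier, Matrix.of_apply,
      ← Complex.exp_add, hr, ← Complex.exp_nat_mul]
    congr 1
    push_cast
    field_simp
    ring
  rw [hsum, Matrix.smul_apply, Matrix.one_apply, smul_eq_mul]
  split_ifs with hjk
  · subst hjk
    simp [hr]
  · have hr1 : r ≠ 1 := by
      intro h
      obtain ⟨n, hn⟩ := Complex.exp_eq_one_iff.mp h
      have hpi : (2 * Real.pi * Complex.I : ℂ) ≠ 0 := Complex.two_pi_I_ne_zero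
      have h1 : ((j : ℕ) : ℂ) - ((k : ℕ) : ℂ) = n * M := by
        rw [div_eq_iff hM] at hn
        apply mul_left_cancel₀ hpi
        rw [hn]
        ring
      have h2 : ((j : ℕ) : ℤ) - ((k : ℕ) : ℤ) = n * M := by exact_mod_cast h1
      have h3 : ((j : ℕ) : ℤ) - ((k : ℕ) : ℤ) = 0 := by
        refine Int.eq_zero_of_abs_lt_dvd (m := (M : ℤ)) ⟨n, by rw [h2, mul_comm]⟩ ?_
        have := j.isLt
        have := k.isLt
        rw [abs_lt]
        omega
      exact hjk (Fin.ext (by omega))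
    have hrM : r ^ M = 1 := by
      rw [hr, ← Complex.exp_nat_mul, Complex.exp_eq_one_iff]
      refine ⟨((j : ℕ) : ℤ) - ((k : ℕ) : ℤ), ?_⟩
      push_cast
      field_simp
    rw [geom_sum_eq hr1, hrM]
    simp

/-- Determinant of a bordered matrix, given a solution `v` of `A v = s`. -/
theorem det_bordered_of_mulVec_eq {R : Type*} [CommRing R] {n : ℕ}
    (A : Matrix (Fin n) (Fin n) R) (hA : IsUnit A.det) (s t v : Fin n → R) (p : R)
    (hv : A *ᵥ v = s) (B : Matrix (Fin (n + 1)) (Fin (n + 1)) R)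
    (hB : ∀ i j : Fin (n + 1), B i j =
      if hi : (i : ℕ) < n then
        (if hj : (j : ℕ) < n then A ⟨i, hi⟩ ⟨j, hj⟩ else s ⟨i, hi⟩)
      else
        (if hj : (j : ℕ) < n then t ⟨j, hj⟩ else p)) :
    B.det = A.det * (p - t ⬝ᵥ v) := by
  have hblock : B.submatrix finSumFinEquiv finSumFinEquiv =
      Matrix.fromBlocks A (Matrix.of fun i (_ : Fin 1) => s i)
        (Matrix.of fun (_ : Fin 1) j => t j) (Matrix.of fun _ _ => p) := by
    ext i j
    rcases i with i | i <;> rcases j with j | j <;> simp [hB]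
  let _ := A.invertibleOfIsUnitDet hA
  have hs : ⅟A * (Matrix.of fun i (_ : Fin 1) => s i) = Matrix.of fun i _ => v i := by
    have : (Matrix.of fun i (_ : Fin 1) => s i) = A * Matrix.of fun i _ => v i := by
      ext i j
      simp [← hv, Matrix.mul_apply, Matrix.mulVec, dotProduct]
    rw [this, Matrix.invOf_mul_cancel_left]
  rw [← Matrix.det_submatrix_equiv_self finSumFinEquiv B, hblock, Matrix.det_fromBlocks₁₁,
    Matrix.mul_assoc, hs, Matrix.det_fin_one]
  simp [Matrix.mul_apply, dotProduct]

/-- Ratio of bordered determinant to determinant: `det B / det A = p − (1/M)∑_k ‖c_k‖²/S_k`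
for the joint spectral-density matrix `B = [[A, s],[sᴴ, p]]`. -/
theorem bordered_det_ratio
    (M : ℕ) (hM : 1 ≤ M) (θ : ℝ) (S : Fin M → ℝ) (hS : ∀ k, 0 < S k)
    (c : Fin M → ℂ) (p : ℝ)
    (A : Matrix (Fin M) (Fin M) ℂ) (s : Fin M → ℂ)
    (B : Matrix (Fin (M + 1)) (Fin (M + 1)) ℂ)
    (hA : ∀ l m : Fin M, A l m =
      (1 / (M : ℂ)) * ∑ k : Fin M, (S k : ℂ) *
        Complex.exp (Complex.I * (((l : ℕ) : ℂ) - ((m : ℕ) : ℂ)) *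
          (((θ - 2 * Real.pi * ((k : ℕ) : ℝ)) / (M : ℝ) : ℝ) : ℂ)))
    (hs : ∀ l : Fin M, s l =
      (1 / (M : ℂ)) * ∑ k : Fin M, c k *
        Complex.exp (Complex.I * ((l : ℕ) : ℂ) *
          (((θ - 2 * Real.pi * ((k : ℕ) : ℝ)) / (M : ℝ) : ℝ) : ℂ)))
    (hB : ∀ i j : Fin (M + 1), B i j =
      if hi : (i : ℕ) < M then
        (if hj : (j : ℕ) < M then A ⟨i, hi⟩ ⟨j, hj⟩ else s ⟨i, hi⟩)
      else
        (if hj : (j : ℕ) < M then (starRingEnd ℂ) (s ⟨j, hj⟩) else (p : ℂ))) :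
    A.det ≠ 0 ∧
      B.det / A.det
        = (((p - (1 / (M : ℝ)) * ∑ k : Fin M, ‖c k‖ ^ 2 / S k : ℝ)) : ℂ) := by
  have hM0 : (M : ℂ) ≠ 0 := Nat.cast_ne_zero.mpr (by omega)
  set F := phasedFourier M θ with hF
  set D : Matrix (Fin M) (Fin M) ℂ := Matrix.diagonal fun k => (S k : ℂ) with hD
  have hFF : Fᴴ * F = (M : ℂ) • 1 := phasedFourier_conjTranspose_mul_self M θ
  have hAF : A = (1 / (M : ℂ)) • (F * D * Fᴴ) := by
    ext l m
    rw [hA, Matrix.smul_apply, smul_eq_mul, Matrix.mul_apply]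
    congr 1
    refine Finset.sum_congr rfl fun k _ => ?_
    rw [hD, Matrix.mul_diagonal, Matrix.conjTranspose_apply, hF, star_phasedFourier_apply,
      phasedFourier, Matrix.of_apply, mul_comm (Complex.exp _) (S k : ℂ),
      mul_assoc (S k : ℂ), ← Complex.exp_add]
    congr 2
    ring
  have hsF : s = (1 / (M : ℂ)) • (F *ᵥ c) := by
    ext l
    rw [hs, Pi.smul_apply, smul_eq_mul, Matrix.mulVec, dotProduct]
    congr 1
    exact Finset.sum_congr rfl fun k _ => mul_comm _ _
  have hdetF : Fᴴ.det * F.det ≠ 0 := by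
    rw [← Matrix.det_mul, hFF, Matrix.det_smul, Matrix.det_one, mul_one]
    exact pow_ne_zero _ hM0
  have hdet : A.det ≠ 0 := by
    rw [hAF, Matrix.det_smul, Matrix.det_mul, Matrix.det_mul, hD, Matrix.det_diagonal]
    refine mul_ne_zero (pow_ne_zero _ (one_div_ne_zero hM0)) (mul_ne_zero (mul_ne_zero
      (right_ne_zero_of_mul hdetF) (Finset.prod_ne_zero_iff.mpr fun k _ => ?_))
      (left_ne_zero_of_mul hdetF))
    exact_mod_cast (hS k).ne'
  refine ⟨hdet, ?_⟩
  set w : Fin M → ℂ := fun k => c k / S k with hw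
  have hDw : D *ᵥ w = c := by
    ext k
    have : (S k : ℂ) ≠ 0 := by exact_mod_cast (hS k).ne'
    rw [hD, Matrix.mulVec_diagonal, hw]
    field_simp
  have hFFw : Fᴴ *ᵥ (F *ᵥ w) = (M : ℂ) • w := by
    rw [Matrix.mulVec_mulVec, hFF, Matrix.smul_mulVec, Matrix.one_mulVec]
  have hv : A *ᵥ ((1 / (M : ℂ)) • (F *ᵥ w)) = s := by
    rw [hAF, hsF, Matrix.smul_mulVec, Matrix.mulVec_smul, ← Matrix.mulVec_mulVec, hFFw,
      Matrix.mulVec_smul, smul_smul (1 / (M : ℂ)) (M : ℂ), one_div_mul_cancel hM0, one_smul,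
      ← Matrix.mulVec_mulVec, hDw]
  rw [det_bordered_of_mulVec_eq A hdet.isUnit s (star s) _ p hv B hB, mul_div_cancel_left₀ _ hdet,
    hsF, star_smul, Matrix.star_mulVec, smul_dotProduct, dotProduct_smul,
    ← Matrix.dotProduct_mulVec, hFFw, dotProduct_smul]
  have hcw : star c ⬝ᵥ w = ∑ k, (‖c k‖ : ℂ) ^ 2 / S k := by
    refine Finset.sum_congr rfl fun k _ => ?_
    rw [hw, Pi.star_apply, Complex.star_def, mul_div_assoc', Complex.conj_mul']
  rw [hcw]
  push_cast
  simp [hM0]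
end
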